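/- Let k > 0, q = exp(−1/(2k²)) and 0 ≤ p < 1, and let (S_n) be the monic orthogonal polynomials with respect to Chihara's weight ρ_0(x) = (−p/(√q x); q)_∞ · (k/√π) exp(−k²(log x)²) on (0,∞). Then the three-term recurrence coefficients are b_n = q^{−n−3/2}(−p − q + (1+q) q^{−n}) and a_n² = q^{−4n}(1 − qⁿ)(1 − p q^{n−1}) for all n ≥ 0. -/

import Mathlib

open MeasureTheory Set

/-- The q-Pochhammer infinite product `(x;q)_∞ = ∏_{k=0}^∞ (1 - x qᵏ)`. -/
noncomputable def qPoch (x q : ℝ) : ℝ := ∏' k : ℕ, (1 - x * q ^ k)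

open Filter Topology

lemma summable_qPoch {q : ℝ} (hq0 : 0 < q) (hq1 : q < 1) (x : ℝ) :
    Summable fun k : ℕ => -(x * q ^ k) :=
  ((summable_geometric_of_lt_one hq0.le hq1).mul_left x).neg

/-- The factor `k = 0` of the `q`-Pochhammer product splits off. -/
lemma qPoch_eq_mul {q : ℝ} (hq0 : 0 < q) (hq1 : q < 1) (x : ℝ) :
    qPoch x q = (1 - x) * qPoch (x * q) q := by
  have hmul : Multipliable fun k : ℕ => 1 - x * q ^ (k + 1) := by
    have h := Real.multipliable_one_add_of_summable (summable_qPoch hq0 hq1 (x * q))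
    refine h.congr fun k => ?_
    ring
  unfold qPoch
  rw [tprod_eq_zero_mul' (f := fun k : ℕ => 1 - x * q ^ k) hmul]
  simp [pow_succ', mul_assoc]

lemma one_le_qPoch_of_nonpos {q : ℝ} (hq0 : 0 < q) (hq1 : q < 1) {x : ℝ} (hx : x ≤ 0) :
    1 ≤ qPoch x q := by
  have h := (Real.multipliable_one_add_of_summable (summable_qPoch hq0 hq1 x)).hasProd
  simp only [← sub_eq_add_neg] at h
  refine ge_of_tendsto' h fun s => ?_
  have hs : ∏ k ∈ s, (1 : ℝ) ≤ ∏ k ∈ s, (1 - x * q ^ k) :=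
    Finset.prod_le_prod (fun _ _ => zero_le_one) fun k _ => by nlinarith [pow_pos hq0 k]
  simpa using hs

lemma continuous_qPoch {q : ℝ} (hq0 : 0 < q) (hq1 : q < 1) :
    Continuous fun x => qPoch x q := by
  refine continuous_iff_continuousAt.2 fun x₀ => ?_
  have hunif : HasProdLocallyUniformlyOn (fun (k : ℕ) (x : ℝ) => 1 + -(x * q ^ k))
      (fun x => ∏' k : ℕ, (1 + -(x * q ^ k))) (Ioo (x₀ - 1) (x₀ + 1)) := by
    refine Summable.hasProdLocallyUniformlyOn_nat_one_add isOpen_Ioo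
      ((summable_geometric_of_lt_one hq0.le hq1).mul_left (|x₀| + 1))
      (Eventually.of_forall fun k x hx => ?_) fun k => by fun_prop
    rw [norm_neg, norm_mul, Real.norm_eq_abs, Real.norm_of_nonneg (pow_nonneg hq0.le k)]
    have : |x| ≤ |x₀| + 1 := by
      have h := abs_sub_abs_le_abs_sub x x₀
      have h' : |x - x₀| ≤ 1 := abs_le.2 ⟨by linarith [hx.1], by linarith [hx.2]⟩
      linarith
    gcongr
  have hcont : ContinuousOn (fun x => ∏' k : ℕ, (1 + -(x * q ^ k)))
      (Ioo (x₀ - 1) (x₀ + 1)) :=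
    TendstoLocallyUniformlyOn.continuousOn hunif
      (Frequently.of_forall fun s => by fun_prop)
  have := hcont.continuousAt (Ioo_mem_nhds (by linarith : x₀ - 1 < x₀) (by linarith))
  simpa only [qPoch, sub_eq_add_neg] using this

/-- A nonnegative function which contracts under the dilation by `q` is integrable near `0`. -/
lemma integrableOn_Ioc_of_dilation_le {g : ℝ → ℝ} {q r δ : ℝ} (hq0 : 0 < q) (hq1 : q < 1)
    (hr : r < 1) (hδ : 0 < δ) (hcont : ContinuousOn g (Ioi 0))
    (hnonneg : ∀ x, 0 < x → 0 ≤ g x)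
    (hle : ∀ x ∈ Ioc 0 δ, q * g (q * x) ≤ r * g x) :
    IntegrableOn g (Ioc 0 δ) := by
  have hint : ∀ a b, 0 < a → 0 < b → IntervalIntegrable g volume a b := fun a b ha hb =>
    (hcont.mono fun x hx => lt_of_lt_of_le (lt_min ha hb) hx.1).intervalIntegrable
  have hqδ : q * δ ≤ δ := by nlinarith
  have hbound : ∀ ε, 0 < ε → ε ≤ δ → ∫ x in ε..δ, g x ≤ (∫ x in (q * δ)..δ, g x) / (1 - r) := by
    intro ε hε hεδ
    have hqε : q * ε ≤ ε := by nlinarith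
    have hqε0 : 0 < q * ε := by positivity
    have hqδ0 : 0 < q * δ := by positivity
    have hmono : ∫ x in ε..δ, g x ≤ ∫ x in (q * ε)..δ, g x := by
      rw [← intervalIntegral.integral_add_adjacent_intervals (hint _ _ hqε0 hε) (hint _ _ hε hδ)]
      have := intervalIntegral.integral_nonneg (μ := volume) hqε
        fun x hx => hnonneg x (hqε0.trans_le hx.1)
      linarith
    have hsplit := intervalIntegral.integral_add_adjacent_intervals
      (hint _ _ hqε0 hqδ0) (hint _ _ hqδ0 hδ)
    have hscale : ∫ x in (q * ε)..(q * δ), g x = ∫ x in ε..δ, q * g (q * x) := by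
      rw [intervalIntegral.integral_const_mul, intervalIntegral.mul_integral_comp_mul_left]
    have hcomp : ∫ x in ε..δ, q * g (q * x) ≤ ∫ x in ε..δ, r * g x := by
      refine intervalIntegral.integral_mono_on hεδ ?_ ((hint _ _ hε hδ).const_mul r)
        fun x hx => hle x ⟨hε.trans_le hx.1, hx.2⟩
      refine IntervalIntegrable.const_mul (ContinuousOn.intervalIntegrable ?_) q
      rw [uIcc_of_le hεδ]
      exact hcont.comp (by fun_prop) fun x hx => mul_pos hq0 (hε.trans_le hx.1)
    rw [← hscale, intervalIntegral.integral_const_mul] at hcomp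
    rw [le_div_iff₀ (by linarith)]
    linarith
  refine integrableOn_Ioc_of_intervalIntegral_norm_bounded_left
    (a := fun n : ℕ => δ * q ^ n) (l := atTop) (I := (∫ x in (q * δ)..δ, g x) / (1 - r))
    (fun n => (hint _ _ (by positivity) hδ).1) ?_ (Eventually.of_forall fun n => ?_)
  · simpa using (tendsto_pow_atTop_nhds_zero_of_lt_one hq0.le hq1).const_mul δ
  · have hn : δ * q ^ n ≤ δ := mul_le_of_le_one_right hδ.le (pow_le_one₀ hq0.le hq1.le)
    have hn0 : 0 < δ * q ^ n := by positivity
    refine le_trans (le_of_eq ?_) (hbound _ hn0 hn)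
    rw [intervalIntegral.integral_of_le hn]
    exact setIntegral_congr_fun measurableSet_Ioc fun x hx =>
      Real.norm_of_nonneg (hnonneg x (hn0.trans hx.1))

/-- A nonnegative function which expands under the dilation by `q` is integrable near `∞`. -/
lemma integrableOn_Ioi_of_le_dilation {g : ℝ → ℝ} {q r A : ℝ} (hq0 : 0 < q) (hq1 : q < 1)
    (hr0 : 0 ≤ r) (hr : r < 1) (hA : 0 < A) (hcont : ContinuousOn g (Ioi 0))
    (hnonneg : ∀ x, 0 < x → 0 ≤ g x)
    (hle : ∀ x, A ≤ x → g x ≤ r * (q * g (q * x))) :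
    IntegrableOn g (Ioi A) := by
  have hint : ∀ a b, 0 < a → 0 < b → IntervalIntegrable g volume a b := fun a b ha hb =>
    (hcont.mono fun x hx => lt_of_lt_of_le (lt_min ha hb) hx.1).intervalIntegrable
  have hqA : q * A ≤ A := by nlinarith
  have hqA0 : 0 < q * A := by positivity
  refine integrableOn_Ioi_of_intervalIntegral_norm_bounded
    (b := id) (l := atTop) (r * (∫ x in (q * A)..A, g x) / (1 - r)) A
    (fun R => ?_) tendsto_id ?_
  · rcases le_or_gt A R with h | h
    · exact (hint _ _ hA (hA.trans_le h)).1
    · simp [Ioc_eq_empty (not_lt.2 h.le)]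
  filter_upwards [eventually_ge_atTop A] with R hR
  have hR0 : 0 < R := hA.trans_le hR
  have hqR0 : 0 < q * R := by positivity
  have hqR : q * R ≤ R := by nlinarith
  have hnorm : ∫ x in A..id R, ‖g x‖ = ∫ x in A..R, g x :=
    intervalIntegral.integral_congr fun x hx => by
      rw [id, uIcc_of_le hR] at hx
      exact Real.norm_of_nonneg (hnonneg x (hA.trans_le hx.1))
  have hmono : ∫ x in (q * A)..(q * R), g x ≤ ∫ x in (q * A)..R, g x := by
    rw [← intervalIntegral.integral_add_adjacent_intervals (hint _ _ hqA0 hqR0)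
      (hint _ _ hqR0 hR0)]
    have := intervalIntegral.integral_nonneg (μ := volume) hqR
      fun x hx => hnonneg x (hqR0.trans_le hx.1)
    linarith
  have hsplit := intervalIntegral.integral_add_adjacent_intervals
    (hint _ _ hqA0 hA) (hint _ _ hA hR0)
  have hscale : ∫ x in (q * A)..(q * R), g x = ∫ x in A..R, q * g (q * x) := by
    rw [intervalIntegral.integral_const_mul, intervalIntegral.mul_integral_comp_mul_left]
  have hcomp : ∫ x in A..R, g x ≤ ∫ x in A..R, r * (q * g (q * x)) := by
    refine intervalIntegral.integral_mono_on hR (hint _ _ hA hR0) ?_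
      fun x hx => hle x hx.1
    refine ((ContinuousOn.intervalIntegrable ?_).const_mul q).const_mul r
    rw [uIcc_of_le hR]
    exact hcont.comp (by fun_prop) fun x hx => mul_pos hq0 (hA.trans_le hx.1)
  rw [intervalIntegral.integral_const_mul, ← hscale] at hcomp
  rw [hnorm, le_div_iff₀ (by linarith)]
  nlinarith [mul_le_mul_of_nonneg_left hmono hr0]

/-- Recurrence coefficients from the moment table `μ n m = L (S n * x ^ m)` of a functional
whose moments satisfy `L (x ^ (m + 1)) = s * (t ^ m - p) * L (x ^ m)`. -/
lemma recurrence_coeffs_of_moments {t s p : ℝ} (ht : 1 < t) (hp : p < 1) (hs : s ≠ 0)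
    (μ : ℕ → ℕ → ℝ) (b a : ℕ → ℝ) (h00 : μ 0 0 ≠ 0)
    (hmom : ∀ m, μ 0 (m + 1) = s * (t ^ m - p) * μ 0 m)
    (horth : ∀ n m, m < n → μ n m = 0)
    (ha : a 0 = 0)
    (hrec : ∀ n m, μ n (m + 1) = μ (n + 1) m + b n * μ n m + a n * μ (n - 1) m) (n : ℕ) :
    b n = s * t ^ n * ((1 + t⁻¹) * t ^ n - p - t⁻¹) ∧
      a n = s ^ 2 * (t ^ n / t) ^ 2 * (t ^ n / t - p) * (t ^ n - 1) := by
  have ht0 : 0 < t := by linarith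
  have hμ0 : ∀ m, μ 0 m ≠ 0 := by
    intro m
    induction m with
    | zero => exact h00
    | succ m ih =>
      rw [hmom]
      have : 1 ≤ t ^ m := one_le_pow₀ ht.le
      exact mul_ne_zero (mul_ne_zero hs (by linarith)) ih
  set D : ℕ → ℕ → ℝ := fun n m => ∏ i ∈ Finset.range n, (s * t ^ i * (t ^ m - t ^ i)) with hD
  have hDsucc : ∀ n m, D (n + 1) m = D n m * (s * t ^ n * (t ^ m - t ^ n)) := fun n m =>
    Finset.prod_range_succ _ _
  have hDshift : ∀ n m, D (n + 1) (m + 1) = s * (t ^ (m + 1) - 1) * (t ^ n) ^ 2 * D n m := by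
    intro n m
    induction n with
    | zero => simp [hD]
    | succ n ih =>
      rw [hDsucc, ih, hDsucc]
      ring
  have hDne : ∀ n m, n ≤ m → D n m ≠ 0 := by
    intro n m hnm
    refine Finset.prod_ne_zero_iff.2 fun i hi => ?_
    have : t ^ i < t ^ m := pow_lt_pow_right₀ ht (by have := Finset.mem_range.1 hi; omega)
    exact mul_ne_zero (mul_ne_zero hs (by positivity)) (by linarith)
  have hb0 : b 0 = s * (1 - p) := by
    have h := hrec 0 0
    rw [hmom, horth 1 0 one_pos, ha] at h
    refine mul_right_cancel₀ h00 ?_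
    linear_combination -h
  have hstep : ∀ j, (∀ m, μ j m = μ 0 m * D j m) → (∀ m, μ (j + 1) m = μ 0 m * D (j + 1) m) →
      a (j + 1) = s ^ 2 * (t ^ j) ^ 2 * (t ^ j - p) * (t * t ^ j - 1) ∧
      b (j + 1) = s * t ^ j * ((t + 1) * t * t ^ j - p * t - 1) ∧
      ∀ m, μ (j + 2) m = μ 0 m * D (j + 2) m := by
    intro j hj hj1
    have key : ∀ m, μ 0 m * D j m * (s ^ 2 * (t ^ m - p) * (t * t ^ m - 1) * (t ^ j) ^ 2) =
        μ (j + 2) m + μ 0 m * D j m * (b (j + 1) * (s * t ^ j * (t ^ m - t ^ j)) + a (j + 1)) := by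
      intro m
      have h := hrec (j + 1) m
      rw [Nat.add_sub_cancel, hj1, hj1, hj, hDshift, hDsucc, hmom] at h
      linear_combination h
    have haj : a (j + 1) = s ^ 2 * (t ^ j) ^ 2 * (t ^ j - p) * (t * t ^ j - 1) := by
      have h := key j
      rw [horth _ _ (by omega : j < j + 2)] at h
      refine mul_left_cancel₀ (mul_ne_zero (hμ0 j) (hDne j j le_rfl)) ?_
      linear_combination -h
    have hbj : b (j + 1) = s * t ^ j * ((t + 1) * t * t ^ j - p * t - 1) := by
      have h := key (j + 1)
      rw [horth _ _ (by omega : j + 1 < j + 2), haj] at h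
      have hne : s * t ^ j * (t ^ (j + 1) - t ^ j) ≠ 0 := by
        have : t ^ j < t ^ (j + 1) := pow_lt_pow_right₀ ht (by omega)
        exact mul_ne_zero (mul_ne_zero hs (by positivity)) (by linarith)
      refine mul_left_cancel₀
        (mul_ne_zero (mul_ne_zero (hμ0 (j + 1)) (hDne j (j + 1) (by omega))) hne) ?_
      linear_combination -h
    refine ⟨haj, hbj, fun m => ?_⟩
    have h := key m
    rw [haj, hbj] at h
    rw [hDsucc, hDsucc]
    linear_combination -h
  have htable : ∀ n, (∀ m, μ n m = μ 0 m * D n m) ∧ ∀ m, μ (n + 1) m = μ 0 m * D (n + 1) m := by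
    intro n
    induction n with
    | zero =>
      refine ⟨fun m => by simp [hD], fun m => ?_⟩
      have h := hrec 0 m
      rw [hmom, ha, hb0] at h
      simp only [hD, Finset.prod_range_succ, Finset.prod_range_zero, pow_zero]
      linear_combination -h
    | succ n ih => exact ⟨ih.2, (hstep n ih.1 ih.2).2.2⟩
  cases n with
  | zero =>
    refine ⟨?_, by simp [ha]⟩
    rw [hb0]
    ring
  | succ j =>
    obtain ⟨haj, hbj, -⟩ := hstep j (htable j).1 (htable j).2
    rw [haj, hbj]
    constructor <;> field_simp <;> ring

/-- Moment recursion for a weight satisfying a `q`-Pearson equation. -/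
lemma moment_succ_of_pearson {ρ : ℝ → ℝ} {q u p : ℝ} (hq0 : 0 < q) (hu : 0 < u)
    (hpearson : ∀ x, 0 < x → ρ (q * x) = (u * x + p / q) * ρ x)
    (hint : ∀ n : ℕ, IntegrableOn (fun x => x ^ n * ρ x) (Ioi 0)) (n : ℕ) :
    ∫ x in Ioi (0 : ℝ), x ^ (n + 1) * ρ x =
      (q * u)⁻¹ * (q⁻¹ ^ n - p) * ∫ x in Ioi (0 : ℝ), x ^ n * ρ x := by
  have hscale := integral_comp_mul_left_Ioi (fun x => x ^ n * ρ x) 0 hq0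
  have hexpand : ∫ x in Ioi (0 : ℝ), (q * x) ^ n * ρ (q * x) =
      ∫ x in Ioi (0 : ℝ), (q ^ n * u * (x ^ (n + 1) * ρ x) + q ^ n * (p / q) * (x ^ n * ρ x)) := by
    refine setIntegral_congr_fun measurableSet_Ioi fun x hx => ?_
    simp only [hpearson x hx]
    ring
  rw [integral_add ((hint _).const_mul _) ((hint _).const_mul _), integral_const_mul,
    integral_const_mul] at hexpand
  rw [hexpand, mul_zero, smul_eq_mul] at hscale
  have hqn : q ^ n ≠ 0 := by positivity
  rw [inv_pow]
  field_simp at hscale ⊢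
  linear_combination hscale

/-- All power moments of a weight satisfying a `q`-Pearson equation with `p < 1` are finite. -/
lemma integrableOn_pow_mul_of_pearson {ρ : ℝ → ℝ} {q u p : ℝ} (hq0 : 0 < q) (hq1 : q < 1)
    (hu : 0 < u) (hp0 : 0 ≤ p) (hp1 : p < 1) (hcont : ContinuousOn ρ (Ioi 0))
    (hnonneg : ∀ x, 0 < x → 0 ≤ ρ x)
    (hpearson : ∀ x, 0 < x → ρ (q * x) = (u * x + p / q) * ρ x) (n : ℕ) :
    IntegrableOn (fun x => x ^ n * ρ x) (Ioi 0) := by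
  have hqu : 0 < q * u := by positivity
  have hcont' : ContinuousOn (fun x => x ^ n * ρ x) (Ioi 0) := by fun_prop
  have hnonneg' : ∀ x, 0 < x → 0 ≤ x ^ n * ρ x := fun x hx =>
    mul_nonneg (pow_nonneg hx.le n) (hnonneg x hx)
  have hdil : ∀ x, 0 < x →
      q * ((q * x) ^ n * ρ (q * x)) = q ^ n * (q * u * x + p) * (x ^ n * ρ x) := by
    intro x hx
    rw [hpearson x hx]
    field_simp
    ring
  have hδ : 0 < (1 - p) / (2 * (q * u)) := div_pos (by linarith) (by positivity)
  have hA : 0 < 2 / (q ^ n * (q * u)) := by positivity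
  have hzero := integrableOn_Ioc_of_dilation_le (r := (1 + p) / 2) hq0 hq1 (by linarith) hδ hcont'
    hnonneg' fun x hx => by
      rw [hdil x hx.1]
      refine mul_le_mul_of_nonneg_right ?_ (hnonneg' x hx.1)
      have h := (le_div_iff₀ (by positivity)).1 hx.2
      have h1 : q ^ n ≤ 1 := pow_le_one₀ hq0.le hq1.le
      have h2 : 0 ≤ q * u * x + p := add_nonneg (mul_pos hqu hx.1).le hp0
      calc q ^ n * (q * u * x + p) ≤ 1 * (q * u * x + p) := by gcongr
        _ ≤ (1 + p) / 2 := by linarith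
  have hinfty := integrableOn_Ioi_of_le_dilation (r := 1 / 2) hq0 hq1 (by norm_num) (by norm_num)
    hA hcont' hnonneg' fun x hx => by
      have hx0 := hA.trans_le hx
      rw [hdil x hx0, ← mul_assoc]
      refine le_mul_of_one_le_left (hnonneg' x hx0) ?_
      have h := (div_le_iff₀ (by positivity)).1 hx
      have h1 : 0 ≤ q ^ n * p := by positivity
      linarith
  have hmid : IntegrableOn (fun x => x ^ n * ρ x)
      (Icc ((1 - p) / (2 * (q * u))) (2 / (q ^ n * (q * u)))) :=
    (hcont'.mono fun x hx => hδ.trans_le hx.1).integrableOn_Icc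
  refine ((hzero.union hmid).union hinfty).mono_set fun x hx => ?_
  by_cases h1 : x ≤ (1 - p) / (2 * (q * u))
  · exact Or.inl (Or.inl ⟨hx, h1⟩)
  by_cases h2 : x ≤ 2 / (q ^ n * (q * u))
  · exact Or.inl (Or.inr ⟨(not_le.1 h1).le, h2⟩)
  · exact Or.inr (not_le.1 h2)

open Polynomial in
/-- Polynomials orthogonal to each other that satisfy a three-term recurrence are orthogonal to
every monomial of lower degree. -/
lemma apply_X_pow_mul_eq_zero (L : ℝ[X] →ₗ[ℝ] ℝ) (S : ℕ → ℝ[X]) (b a : ℕ → ℝ) (hS0 : S 0 = 1)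
    (horth : ∀ m n, m ≠ n → L (S m * S n) = 0)
    (hrec : ∀ n, X * S n = S (n + 1) + b n • S n + a n • S (n - 1)) {n m : ℕ} (hmn : m < n) :
    L (X ^ m * S n) = 0 := by
  have key : ∀ i j, i + j < n → L (X ^ i * S j * S n) = 0 := by
    intro i
    induction i with
    | zero =>
      intro j hj
      simpa using horth j n (by omega)
    | succ i ih =>
      intro j hj
      have hexpand : X ^ (i + 1) * S j * S n = X ^ i * S (j + 1) * S n +
          b j • (X ^ i * S j * S n) + a j • (X ^ i * S (j - 1) * S n) := by
        rw [pow_succ, mul_assoc (X ^ i) X, hrec]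
        simp only [mul_add, add_mul, mul_smul_comm, smul_mul_assoc]
      rw [hexpand, map_add, map_add, map_smul, map_smul, ih _ (by omega), ih _ (by omega),
        ih _ (by omega)]
      simp
  simpa [hS0] using key m 0 hmn

/-- Chihara's weight satisfies a `q`-Pearson equation. -/
lemma chihara_weight_pearson {k q : ℝ} (hk : 0 < k) (hq : q = Real.exp (-1 / (2 * k ^ 2)))
    (p : ℝ) {x : ℝ} (hx : 0 < x) :
    qPoch (-(p / (Real.sqrt q * (q * x)))) q
        * (k / Real.sqrt Real.pi * Real.exp (-k ^ 2 * Real.log (q * x) ^ 2)) =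
      (Real.sqrt q * x + p / q) * (qPoch (-(p / (Real.sqrt q * x))) q
        * (k / Real.sqrt Real.pi * Real.exp (-k ^ 2 * Real.log x ^ 2))) := by
  have hq0 : 0 < q := hq ▸ Real.exp_pos _
  have hq1 : q < 1 := by
    rw [hq, Real.exp_lt_one_iff]
    exact div_neg_of_neg_of_pos (by norm_num) (by positivity)
  have hsq : 0 < Real.sqrt q := Real.sqrt_pos.2 hq0
  have hlogq : Real.log q = -1 / (2 * k ^ 2) := by rw [hq, Real.log_exp]
  have hexp : Real.exp (-k ^ 2 * Real.log (q * x) ^ 2) =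
      Real.sqrt q * x * Real.exp (-k ^ 2 * Real.log x ^ 2) := by
    have hsqrt : Real.sqrt q = Real.exp (-1 / (2 * k ^ 2) / 2) := by rw [hq, Real.exp_half]
    rw [hsqrt, ← Real.exp_log hx, ← Real.exp_add, ← Real.exp_add, Real.exp_log hx,
      Real.log_mul hq0.ne' hx.ne', hlogq]
    congr 1
    field_simp
    ring
  have harg : -(p / (Real.sqrt q * (q * x))) * q = -(p / (Real.sqrt q * x)) := by
    field_simp
  rw [qPoch_eq_mul hq0 hq1, harg, hexp]
  field_simp
  ring

/-- Recurrence coefficients of the monic orthogonal polynomials for Chihara's weight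
`ρ₀(x) = (-p/(√q x);q)_∞ w_k(x)`:
`b_n = q^{-n-3/2}(-p-q+(1+q)q^{-n})` and `a_n² = q^{-4n}(1-qⁿ)(1-pq^{n-1})`. -/
theorem chihara_qLaguerre_recurrence_coefficients
    (k : ℝ) (hk : 0 < k) (q : ℝ) (hq : q = Real.exp (-1 / (2 * k ^ 2)))
    (p : ℝ) (hp0 : 0 ≤ p) (hp1 : p < 1)
    (ρ : ℝ → ℝ)
    (hρ : ∀ x : ℝ, 0 < x →
      ρ x = qPoch (-(p / (Real.sqrt q * x))) q
        * (k / Real.sqrt Real.pi * Real.exp (-k ^ 2 * Real.log x ^ 2)))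
    (S : ℕ → Polynomial ℝ)
    (hmonic : ∀ n, (S n).Monic)
    (hdeg : ∀ n, (S n).natDegree = n)
    (horth : ∀ m n : ℕ, m ≠ n →
      ∫ x in Ioi (0 : ℝ), (S m).eval x * (S n).eval x * ρ x = 0)
    (b a2 : ℕ → ℝ)
    (ha0 : a2 0 = 0)
    (hrec : ∀ n : ℕ, ∀ x : ℝ,
      x * (S n).eval x
        = (S (n + 1)).eval x + b n * (S n).eval x + a2 n * (S (n - 1)).eval x) :
    ∀ n : ℕ,
      b n = q ^ (-(n : ℝ) - 3 / 2) * (-p - q + (1 + q) * q ^ (-(n : ℝ))) ∧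
      a2 n = q ^ (-4 * (n : ℝ)) * (1 - q ^ (n : ℝ)) * (1 - p * q ^ ((n : ℝ) - 1)) := by
  have hq0 : 0 < q := hq ▸ Real.exp_pos _
  have hq1 : q < 1 := by
    rw [hq, Real.exp_lt_one_iff]
    exact div_neg_of_neg_of_pos (by norm_num) (by positivity)
  have hsq : 0 < Real.sqrt q := Real.sqrt_pos.2 hq0
  have hpos : ∀ x, 0 < x → 0 < ρ x := by
    intro x hx
    have h := one_le_qPoch_of_nonpos hq0 hq1 (x := -(p / (Real.sqrt q * x)))
      (neg_nonpos.2 (by positivity))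
    rw [hρ x hx]
    have : 0 < qPoch (-(p / (Real.sqrt q * x))) q := by linarith
    positivity
  have hcont : ContinuousOn ρ (Ioi 0) := by
    refine ContinuousOn.congr (ContinuousOn.mul ?_ ?_) fun x hx => hρ x hx
    · refine (continuous_qPoch hq0 hq1).comp_continuousOn (ContinuousOn.neg ?_)
      exact continuousOn_const.div (by fun_prop) fun x hx => (mul_pos hsq hx).ne'
    · have : ContinuousOn Real.log (Ioi 0) :=
        Real.continuousOn_log.mono fun x hx => ne_of_gt hx
      fun_prop
  have hpearson : ∀ x, 0 < x → ρ (q * x) = (Real.sqrt q * x + p / q) * ρ x := by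
    intro x hx
    rw [hρ x hx, hρ _ (mul_pos hq0 hx), chihara_weight_pearson hk hq p hx]
  have hint := integrableOn_pow_mul_of_pearson hq0 hq1 hsq hp0 hp1 hcont
    (fun x hx => (hpos x hx).le) hpearson
  have hintPoly : ∀ f : Polynomial ℝ, IntegrableOn (fun x => f.eval x * ρ x) (Ioi 0) := by
    intro f
    simp only [Polynomial.eval_eq_sum_range, Finset.sum_mul, mul_assoc]
    exact integrable_finsetSum _ fun i _ => (hint i).const_mul _
  let L : Polynomial ℝ →ₗ[ℝ] ℝ :=
    { toFun := fun f => ∫ x in Ioi (0 : ℝ), f.eval x * ρ x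
      map_add' := fun f g => by
        simp only [Polynomial.eval_add, add_mul]
        exact integral_add (hintPoly f) (hintPoly g)
      map_smul' := fun c f => by
        simp only [Polynomial.eval_smul, smul_eq_mul, mul_assoc, RingHom.id_apply]
        exact integral_const_mul _ _ }
  have hL : ∀ f, L f = ∫ x in Ioi (0 : ℝ), f.eval x * ρ x := fun f => rfl
  have hS0 : S 0 = 1 := Polynomial.eq_one_of_monic_natDegree_zero (hmonic 0) (hdeg 0)
  have hrecPoly : ∀ n, Polynomial.X * S n = S (n + 1) + b n • S n + a2 n • S (n - 1) :=
    fun n => Polynomial.funext fun x => by simpa using hrec n x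
  have horthL : ∀ m n, m ≠ n → L (S m * S n) = 0 := fun m n hmn => by
    simpa [hL] using horth m n hmn
  have hq1' : 1 < q⁻¹ := (one_lt_inv₀ hq0).2 hq1
  have hs : (q * Real.sqrt q)⁻¹ = q ^ (-(3 / 2) : ℝ) := by
    rw [Real.rpow_neg hq0.le, Real.sqrt_eq_rpow, ← Real.rpow_one_add' hq0.le (by norm_num)]
    norm_num
  have hs2 : (q * Real.sqrt q)⁻¹ ^ 2 = (q ^ 3)⁻¹ := by
    rw [inv_pow, mul_pow, Real.sq_sqrt hq0.le, pow_succ q 2]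
  intro n
  have hmain := recurrence_coeffs_of_moments (s := (q * Real.sqrt q)⁻¹) hq1' hp1
    (by positivity) (fun n m => L (Polynomial.X ^ m * S n)) b a2
    (by
      have : 0 < ∫ x in Ioi (0 : ℝ), ρ x := by
        rw [setIntegral_pos_iff_support_of_nonneg_ae]
        · have hsub : Ioi (0 : ℝ) ⊆ Function.support ρ ∩ Ioi 0 := fun x hx =>
            ⟨(hpos x hx).ne', hx⟩
          exact lt_of_lt_of_le (by simp) (measure_mono hsub)
        · exact (ae_restrict_iff' measurableSet_Ioi).2
            (Eventually.of_forall fun x hx => (hpos x hx).le)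
        · simpa using hint 0
      simpa [hL, hS0] using this.ne')
    (fun m => by
      simpa [hL, hS0] using moment_succ_of_pearson hq0 hsq hpearson hint m)
    (fun n m hmn => apply_X_pow_mul_eq_zero L S b a2 hS0 horthL hrecPoly hmn) ha0
    (fun n m => by
      have hexpand : Polynomial.X ^ (m + 1) * S n = Polynomial.X ^ m * S (n + 1) +
          b n • (Polynomial.X ^ m * S n) + a2 n • (Polynomial.X ^ m * S (n - 1)) := by
        rw [pow_succ, mul_assoc, hrecPoly]
        simp only [mul_add, mul_smul_comm]
      rw [hexpand, map_add, map_add, map_smul, map_smul, smul_eq_mul, smul_eq_mul]) n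
  have hqn : q ^ n ≠ 0 := by positivity
  have h4 : q ^ (-4 * (n : ℝ)) = ((q ^ n) ^ 4)⁻¹ := by
    rw [neg_mul, Real.rpow_neg hq0.le, mul_comm, Real.rpow_mul hq0.le, Real.rpow_natCast]
    norm_cast
  rw [sub_eq_add_neg (-(n : ℝ)), Real.rpow_add hq0, ← hs, h4, Real.rpow_sub_one hq0.ne',
    Real.rpow_neg hq0.le, Real.rpow_natCast, hmain.1, hmain.2, hs2, inv_inv, inv_pow]
  constructor
  · field_simp
    ring
  · field_simp
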